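/- If n = p₁ p₂ where p₁ and p₂ are distinct primes both ≥ 17, then the quotient algebra E = (A#C_n)/(e₀) is finite-dimensional as a k-vector space (i.e., n is admissible and p(A, C_n) = n). -/

import Mathlib

open scoped BigOperators

namespace NCIS

variable (k : Type*) [Field k] (n : ℕ)

/-- Relations defining the skew group algebra `A # C_n`, where
`A = k_{-1}[x_0, …, x_{n-1}]`: the generators are `x_i` (`Sum.inl i`) and `s` (`Sum.inr ()`),
subject to `x_i x_j + x_j x_i = 0` for `i ≠ j`, `s^n = 1` and `s x_i = x_{i+1} s`. -/
inductive SGRel : FreeAlgebra k (ZMod n ⊕ Unit) → FreeAlgebra k (ZMod n ⊕ Unit) → Prop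
  | anti (i j : ZMod n) (h : i ≠ j) :
      SGRel (FreeAlgebra.ι k (Sum.inl i) * FreeAlgebra.ι k (Sum.inl j)
           + FreeAlgebra.ι k (Sum.inl j) * FreeAlgebra.ι k (Sum.inl i)) 0
  | spow : SGRel (FreeAlgebra.ι k (Sum.inr ()) ^ n) 1
  | scomm (i : ZMod n) :
      SGRel (FreeAlgebra.ι k (Sum.inr ()) * FreeAlgebra.ι k (Sum.inl i))
            (FreeAlgebra.ι k (Sum.inl (i + 1)) * FreeAlgebra.ι k (Sum.inr ()))

/-- The skew group algebra `A # C_n`. -/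
abbrev SkewGroup := RingQuot (SGRel k n)

/-- The image of the generator `x_i` in `A # C_n`. -/
noncomputable def xg (i : ZMod n) : SkewGroup k n :=
  RingQuot.mkAlgHom k (SGRel k n) (FreeAlgebra.ι k (Sum.inl i))

/-- The image of the generator `s` in `A # C_n`. -/
noncomputable def sg : SkewGroup k n :=
  RingQuot.mkAlgHom k (SGRel k n) (FreeAlgebra.ι k (Sum.inr ()))

/-- The integral `e₀ = (1/n) ∑_{i=0}^{n-1} s^i` in `A # C_n`. -/
noncomputable def e0 : SkewGroup k n := (n : k)⁻¹ • ∑ i ∈ Finset.range n, sg k n ^ i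

/-- The quotient algebra `E = (A # C_n)/(e₀)` of `A # C_n` by the two-sided ideal
generated by `e₀`. -/
abbrev Equot := RingQuot (fun a b : SkewGroup k n => a = e0 k n ∧ b = 0)

end NCIS

/-- Let `B γ` behave on `K` like the eigenvectors of an order-`m` rotation `τ` acting on a Clifford
algebra, with `y` playing the role of the quadratic form. If `m ≥ 7` is odd and `K` is not contained
in the `y`-saturated subspace `T`, then `τ` fixes some element of `K` outside `T`. -/
theorem exists_fixed_of_clifford {k E : Type*} [Field k] [CharZero k] [Ring E] [Algebra k E]
    {m : ℕ} (hm : Odd m) (hm7 : 7 ≤ m) {ζ : k} (hζ : IsPrimitiveRoot ζ m) {c : k} (hc : c ≠ 0)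
    (K T : Submodule k E) (B : ℤ → E) (τ y : E) (hτ : τ ^ m = 1)
    (hτB : ∀ γ, τ * B γ = ζ ^ γ • (B γ * τ))
    (hKB : ∀ γ, ∀ v ∈ K, B γ * v ∈ K) (hKτ : ∀ v ∈ K, τ * v ∈ K)
    (hTB : ∀ γ, ∀ v ∈ T, B γ * v ∈ T) (hyT : ∀ v, y * v ∈ T → v ∈ T)
    (hBB : ∀ γ δ, ¬ (m : ℤ) ∣ γ + δ → ∀ v ∈ K, B γ * (B δ * v) = -(B δ * (B γ * v)))
    (hB : ∀ γ, ∀ v ∈ K, B (-γ) * (B γ * v) + B γ * (B (-γ) * v) = c • (y * v))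
    (h0 : ∃ v ∈ K, v ∉ T) : ∃ v ∈ K, v ∉ T ∧ τ * v = v := by
  have hm0 : m ≠ 0 := by omega
  have hζ0 : ζ ≠ 0 := hζ.ne_zero hm0
  -- an eigenvector of `τ` outside `T`
  have eigen : ∃ v ∈ K, v ∉ T ∧ ∃ α : ℤ, τ * v = ζ ^ α • v := by
    obtain ⟨v, hvK, hvT⟩ := h0
    have hpow : ∀ i : ℕ, τ ^ i * v ∈ K := by
      intro i
      induction i with
      | zero => simpa using hvK
      | succ i ih => rw [pow_succ', mul_assoc]; exact hKτ _ ih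
    let u : ℕ → E := fun a => ∑ i ∈ Finset.range m, (ζ ^ a)⁻¹ ^ i • (τ ^ i * v)
    have huK : ∀ a, u a ∈ K := fun a =>
      K.sum_mem fun i _ => K.smul_mem _ (hpow i)
    have hu : ∀ a, τ * u a = ζ ^ a • u a := by
      intro a
      have hne : ζ ^ a ≠ 0 := pow_ne_zero _ hζ0
      have key : ∑ i ∈ Finset.range m, (ζ ^ a)⁻¹ ^ (i + 1) • (τ ^ (i + 1) * v) = u a := by
        have e1 := Finset.sum_range_succ (fun i => (ζ ^ a)⁻¹ ^ i • (τ ^ i * v)) m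
        rw [Finset.sum_range_succ'] at e1
        have e2 : (ζ ^ a)⁻¹ ^ m = 1 := by
          rw [inv_pow, ← pow_mul, mul_comm, pow_mul, hζ.pow_eq_one, one_pow, inv_one]
        rw [hτ, e2, pow_zero, pow_zero] at e1
        exact add_right_cancel e1
      conv_rhs => rw [← key]
      simp only [u, Finset.mul_sum, Finset.smul_sum]
      refine Finset.sum_congr rfl fun i _ => ?_
      rw [mul_smul_comm, smul_smul, pow_succ', ← mul_assoc (ζ ^ a), mul_inv_cancel₀ hne, one_mul,
        pow_succ', mul_assoc]
    have hsum : ∑ a ∈ Finset.range m, u a = (m : k) • v := by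
      simp only [u]
      rw [Finset.sum_comm, Finset.sum_eq_single_of_mem 0 (by simp; omega)]
      · simp [← Nat.cast_smul_eq_nsmul k]
      · intro i hi hi0
        rw [← Finset.sum_smul]
        have h1 : (ζ ^ i)⁻¹ ≠ 1 := by
          rw [ne_eq, inv_eq_one]
          exact hζ.pow_ne_one_of_pos_of_lt hi0 (Finset.mem_range.1 hi)
        have h2 : ∑ a ∈ Finset.range m, (ζ ^ a)⁻¹ ^ i = ∑ a ∈ Finset.range m, (ζ ^ i)⁻¹ ^ a := by
          refine Finset.sum_congr rfl fun a _ => ?_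
          rw [inv_pow, inv_pow, ← pow_mul, ← pow_mul, mul_comm]
        rw [h2, geom_sum_eq h1, inv_pow, ← pow_mul, mul_comm, pow_mul, hζ.pow_eq_one]
        simp
    by_contra! hcon
    apply hvT
    have hall : ∀ a, u a ∈ T := by
      intro a
      by_contra ha
      exact hcon _ (huK a) ha a (by rw [hu a, zpow_natCast])
    have h3 : (m : k) • v ∈ T := hsum ▸ T.sum_mem fun a _ => hall a
    exact (T.smul_mem_iff (by exact_mod_cast hm0)).1 h3
  have shift : ∀ (γ α : ℤ) (v : E), τ * v = ζ ^ α • v → τ * (B γ * v) = ζ ^ (γ + α) • (B γ * v) := by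
    intro γ α v hv
    rw [← mul_assoc, hτB, smul_mul_assoc, mul_assoc, hv, mul_smul_comm, smul_smul, zpow_add₀ hζ0]
  obtain ⟨r, hr⟩ := hm
  have ndvd : ∀ a : ℤ, a ≠ 0 → |a| < m → ¬ (m : ℤ) ∣ a := fun a h0 h1 h2 =>
    h0 (Int.eq_zero_of_abs_lt_dvd h2 h1)
  -- a lowest-weight eigenvector modulo `T`
  have lowest : ∀ t ≤ r, ∃ v ∈ K, v ∉ T ∧ (∃ α : ℤ, τ * v = ζ ^ α • v) ∧
      ∀ γ : ℕ, 1 ≤ γ → γ ≤ t → B (-γ) * v ∈ T := by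
    intro t
    induction t with
    | zero =>
      intro _
      obtain ⟨v, hK, hT, hα⟩ := eigen
      exact ⟨v, hK, hT, hα, fun γ h1 h2 => by omega⟩
    | succ t ih =>
      intro ht
      obtain ⟨v, hK, hT, ⟨α, hα⟩, hv⟩ := ih (by omega)
      by_cases h : B (-((t + 1 : ℕ) : ℤ)) * v ∈ T
      · refine ⟨v, hK, hT, ⟨α, hα⟩, fun γ h1 h2 => ?_⟩
        rcases Nat.lt_or_ge t γ with h3 | h3
        · obtain rfl : γ = t + 1 := by omega
          exact h
        · exact hv γ h1 h3
      · refine ⟨_, hKB _ _ hK, h, ⟨_, shift _ _ _ hα⟩, fun γ h1 h2 => ?_⟩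
        have hanti := hBB (-γ) (-((t + 1 : ℕ) : ℤ))
          (ndvd _ (by omega) (by rw [abs_lt]; omega)) v hK
        rcases Nat.lt_or_ge t γ with h3 | h3
        · obtain rfl : γ = t + 1 := by omega
          have htwo : (2 : k) • (B (-((t + 1 : ℕ) : ℤ)) * (B (-((t + 1 : ℕ) : ℤ)) * v)) = 0 := by
            rw [two_smul]
            exact add_eq_zero_iff_eq_neg.2 hanti
          rw [(smul_eq_zero_iff_right two_ne_zero).1 htwo]
          exact T.zero_mem
        · rw [hanti]
          exact T.neg_mem (hTB _ _ (hv γ h1 h3))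
  obtain ⟨v, hK, hT, ⟨α, hα⟩, hv⟩ := lowest r le_rfl
  -- raising reaches every eigenvalue
  have raise : ∀ t ≤ r, ∀ N : ℕ, 2 * N ≤ t * (t + 1) → ∃ w ∈ K, w ∉ T ∧
      τ * w = ζ ^ (N + α) • w ∧ ∀ γ : ℕ, t < γ → γ ≤ r → B (-γ) * w ∈ T := by
    intro t
    induction t with
    | zero =>
      intro _ N hN
      obtain rfl : N = 0 := by omega
      exact ⟨v, hK, hT, by simpa using hα, fun γ h1 h2 => hv γ h1 h2⟩
    | succ t ih =>
      intro ht N hN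
      rcases le_or_gt (2 * N) (t * (t + 1)) with h | h
      · obtain ⟨w, h1, h2, h3, h4⟩ := ih (by omega) N h
        exact ⟨w, h1, h2, h3, fun γ h5 h6 => h4 γ (by omega) h6⟩
      · have hle : t + 1 ≤ N := by
          rcases Nat.eq_zero_or_pos t with rfl | ht0
          · omega
          · nlinarith
        obtain ⟨M, rfl⟩ := Nat.exists_eq_add_of_le hle
        obtain ⟨w, h1, h2, h3, h4⟩ := ih (by omega) M (by nlinarith)
        refine ⟨B ((t + 1 : ℕ) : ℤ) * w, hKB _ _ h1, fun hmem => h2 ?_, ?_, fun γ h5 h6 => ?_⟩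
        · have h7 := hB ((t + 1 : ℕ) : ℤ) w h1
          have h8 : c • (y * w) ∈ T := h7 ▸ T.add_mem (hTB _ _ hmem)
            (hTB _ _ (h4 (t + 1) (by omega) (by omega)))
          exact hyT _ ((T.smul_mem_iff hc).1 h8)
        · rw [shift _ _ _ h3]
          congr 2
          push_cast
          ring
        · rw [hBB (-γ) ((t + 1 : ℕ) : ℤ) (ndvd _ (by omega) (by rw [abs_lt]; omega)) w h1]
          exact T.neg_mem (hTB _ _ (h4 γ (by omega) h6))
  have hmpos : (0 : ℤ) < m := by omega
  obtain ⟨N, hN⟩ : ∃ N : ℕ, (N : ℤ) = (-α) % m := ⟨((-α) % m).toNat,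
    Int.toNat_of_nonneg (Int.emod_nonneg _ hmpos.ne')⟩
  have hNlt : (N : ℤ) < m := hN ▸ Int.emod_lt_of_pos _ hmpos
  have hN2 : 2 * N ≤ r * (r + 1) := by
    have : 3 ≤ r := by omega
    nlinarith
  obtain ⟨w, h1, h2, h3, -⟩ := raise r le_rfl N hN2
  refine ⟨w, h1, h2, ?_⟩
  have h4 : (m : ℤ) ∣ N + α := by
    have := Int.emod_add_mul_ediv (-α) m
    exact ⟨-((-α) / m), by rw [hN]; linarith⟩
  rw [h3, (hζ.zpow_eq_one_iff_dvd _).2 h4, one_smul]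

section GeomSum

variable {R : Type*} [IdemSemiring R]

theorem mul_geom_sum_le (a : R) (d : ℕ) :
    a * ∑ i ∈ Finset.range d, a ^ i ≤ ∑ i ∈ Finset.range d, a ^ i + a ^ d := by
  rw [← Finset.sum_range_succ, Finset.sum_range_succ', Finset.mul_sum, add_eq_sup]
  simp only [← pow_succ']
  exact le_sup_left

theorem one_le_geom_sum (a : R) {d : ℕ} (hd : d ≠ 0) : 1 ≤ ∑ i ∈ Finset.range d, a ^ i := by
  obtain ⟨d, rfl⟩ := Nat.exists_eq_succ_of_ne_zero hd
  rw [Finset.sum_range_succ', pow_zero, add_eq_sup]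
  exact le_sup_right

end GeomSum

/-- A family of `n` pairwise anticommuting elements of a ring, permuted cyclically under
conjugation by an element `s` with `s ^ n = 1`. -/
structure IsSkewCyclic {n : ℕ} {E : Type*} [Ring E] (x : ZMod n → E) (s : E) : Prop where
  anti : ∀ i j, i ≠ j → x i * x j + x j * x i = 0
  pow_eq_one : s ^ n = 1
  comm : ∀ i, s * x i = x (i + 1) * s

namespace IsSkewCyclic

section Ring

variable {n : ℕ} {E : Type*} [Ring E] {x : ZMod n → E} {s : E}

theorem sq_commute (h : IsSkewCyclic x s) (i j : ZMod n) : Commute (x i ^ 2) (x j) := by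
  rcases eq_or_ne i j with rfl | hij
  · exact (Commute.refl _).pow_left 2
  · have h1 : x i * x j = -(x j * x i) := add_eq_zero_iff_eq_neg.1 (h.anti i j hij)
    calc x i ^ 2 * x j = x i * (x i * x j) := by rw [sq, mul_assoc]
      _ = -(x i * x j) * x i := by rw [h1, mul_neg, ← mul_assoc, ← neg_mul, h1]
      _ = x j * x i ^ 2 := by rw [h1, neg_neg, sq, mul_assoc]

theorem pow_mul (h : IsSkewCyclic x s) (a : ℕ) (i : ZMod n) :
    s ^ a * x i = x (i + a) * s ^ a := by
  induction a generalizing i with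
  | zero => simp
  | succ a ih =>
    rw [pow_succ, mul_assoc, h.comm, ← mul_assoc, ih, mul_assoc]
    push_cast
    rw [add_assoc, add_comm (1 : ZMod n)]

theorem pow_val_mul [NeZero n] (h : IsSkewCyclic x s) (g i : ZMod n) :
    s ^ g.val * x i = x (i + g) * s ^ g.val := by
  rw [h.pow_mul, ZMod.natCast_zmod_val]

theorem pow_val_mul_sq [NeZero n] (h : IsSkewCyclic x s) (g i : ZMod n) :
    s ^ g.val * x i ^ 2 = x (i + g) ^ 2 * s ^ g.val := by
  rw [sq, ← mul_assoc, h.pow_val_mul, mul_assoc, h.pow_val_mul, ← mul_assoc, ← sq]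

theorem pow_val_add [NeZero n] (h : IsSkewCyclic x s) (a b : ZMod n) :
    s ^ (a + b).val = s ^ a.val * s ^ b.val := by
  rw [ZMod.val_add, ← pow_eq_pow_mod _ h.pow_eq_one, pow_add]

theorem pow_val_nsmul [NeZero n] (h : IsSkewCyclic x s) (a : ℕ) (g : ZMod n) :
    s ^ (a • g).val = (s ^ g.val) ^ a := by
  induction a with
  | zero => simp
  | succ a ih => rw [succ_nsmul, h.pow_val_add, ih, pow_succ]

end Ring

section Algebra

variable {k : Type*} [Field k] {n : ℕ} {E : Type*} [Ring E] [Algebra k E] {x : ZMod n → E} {s : E}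

variable (k x) in
/-- The elements of `E` on which left multiplication by `x p.1 ^ 2` and by `x p.2 ^ 2` agree for
all `p ∈ D`. -/
def coincidence (D : Set (ZMod n × ZMod n)) : Submodule k E where
  carrier := {v | ∀ p ∈ D, x p.1 ^ 2 * v = x p.2 ^ 2 * v}
  add_mem' hv hw p hp := by rw [mul_add, mul_add, hv p hp, hw p hp]
  zero_mem' p _ := by simp
  smul_mem' c v hv p hp := by rw [mul_smul_comm, mul_smul_comm, hv p hp]

variable (k) in
/-- The elements of `E` killed by left multiplication by a power of `y`. -/
def leftTorsion (y : E) : Submodule k E where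
  carrier := {v | ∃ a : ℕ, y ^ a * v = 0}
  add_mem' := by
    rintro v w ⟨a, ha⟩ ⟨b, hb⟩
    refine ⟨a + b, ?_⟩
    rw [mul_add, pow_add, mul_assoc _ _ w, hb, (Commute.pow_pow (Commute.refl y) a b).eq,
      mul_assoc, ha, mul_zero, mul_zero, add_zero]
  zero_mem' := ⟨0, by simp⟩
  smul_mem' := by
    rintro c v ⟨a, ha⟩
    exact ⟨a, by rw [mul_smul_comm, ha, smul_zero]⟩

theorem mem_leftTorsion_of_mul_mem {y v : E} (h : y * v ∈ leftTorsion k y) :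
    v ∈ leftTorsion k y := by
  obtain ⟨a, ha⟩ := h
  exact ⟨a + 1, by rw [pow_succ, mul_assoc, ha]⟩

theorem mul_mem_leftTorsion {y z v : E} (hz : Commute y z) (hv : v ∈ leftTorsion k y) :
    z * v ∈ leftTorsion k y := by
  obtain ⟨a, ha⟩ := hv
  exact ⟨a, by rw [← mul_assoc, (hz.pow_left a).eq, mul_assoc, ha, mul_zero]⟩

theorem mul_mem_coincidence {D : Set (ZMod n × ZMod n)} {z v : E}
    (hz : ∀ i, Commute (x i ^ 2) z) (hv : v ∈ coincidence k x D) : z * v ∈ coincidence k x D := by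
  intro p hp
  rw [← mul_assoc, ← mul_assoc, (hz _).eq, (hz _).eq, mul_assoc, mul_assoc, hv p hp]

/-- The Fourier transform of the restriction of `x` to the multiples of `η`. -/
def fourier (x : ZMod n → E) (m : ℕ) (η : ZMod n) (ζ : k) (γ : ℤ) : E :=
  ∑ j ∈ Finset.range m, (ζ ^ (-γ)) ^ j • x (j • η)

theorem sq_commute_fourier (h : IsSkewCyclic x s) (m : ℕ) (η : ZMod n) (ζ : k) (γ : ℤ)
    (i : ZMod n) : Commute (x i ^ 2) (fourier x m η ζ γ) :=
  Commute.sum_right _ _ _ fun _ _ => (h.sq_commute _ _).smul_right _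

theorem pow_val_mul_fourier [NeZero n] (h : IsSkewCyclic x s) {m : ℕ} {η : ZMod n}
    (hη : m • η = 0) {ζ : k} (hζ : IsPrimitiveRoot ζ m) (hm : m ≠ 0) (γ : ℤ) :
    s ^ η.val * fourier x m η ζ γ = ζ ^ γ • (fourier x m η ζ γ * s ^ η.val) := by
  have hζ0 : ζ ≠ 0 := hζ.ne_zero hm
  have key : ∑ j ∈ Finset.range m, (ζ ^ (-γ)) ^ (j + 1) • x ((j + 1) • η)
      = fourier x m η ζ γ := by
    have e1 := Finset.sum_range_succ (fun j => (ζ ^ (-γ)) ^ j • x (j • η)) m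
    rw [Finset.sum_range_succ'] at e1
    have e2 : (ζ ^ (-γ)) ^ m = 1 := by
      rw [← zpow_natCast, zpow_comm, zpow_natCast, hζ.pow_eq_one, one_zpow]
    rw [hη, e2, pow_zero, zero_nsmul] at e1
    exact add_right_cancel e1
  conv_rhs => rw [← key]
  rw [fourier, Finset.mul_sum, Finset.sum_mul, Finset.smul_sum]
  refine Finset.sum_congr rfl fun j _ => ?_
  rw [mul_smul_comm, h.pow_val_mul, smul_mul_assoc, smul_smul, pow_succ', ← mul_assoc,
    ← zpow_add₀ hζ0, add_neg_cancel, zpow_zero, one_mul, succ_nsmul]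

theorem fourier_anticomm (h : IsSkewCyclic x s) {η : ZMod n} {m : ℕ} (hm : addOrderOf η = m)
    (ζ : k) (γ δ : ℤ) (hζ0 : ζ ≠ 0) :
    fourier x m η ζ γ * fourier x m η ζ δ + fourier x m η ζ δ * fourier x m η ζ γ
      = ∑ j ∈ Finset.range m, (2 * (ζ ^ (-(γ + δ))) ^ j) • x (j • η) ^ 2 := by
  have e : fourier x m η ζ δ * fourier x m η ζ γ = ∑ i ∈ Finset.range m, ∑ j ∈ Finset.range m,
      ((ζ ^ (-γ)) ^ i * (ζ ^ (-δ)) ^ j) • (x (j • η) * x (i • η)) := by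
    rw [fourier, fourier, Finset.sum_mul_sum, Finset.sum_comm]
    refine Finset.sum_congr rfl fun i _ => Finset.sum_congr rfl fun j _ => ?_
    rw [smul_mul_smul_comm, mul_comm]
  rw [e, fourier, fourier, Finset.sum_mul_sum, ← Finset.sum_add_distrib]
  refine Finset.sum_congr rfl fun i hi => ?_
  rw [← Finset.sum_add_distrib, Finset.sum_eq_single_of_mem i hi]
  · rw [smul_mul_smul_comm, ← smul_add, ← sq, ← two_smul k, smul_smul, neg_add, zpow_add₀ hζ0,
      mul_pow, mul_comm 2]
  · intro j hj hji
    rw [smul_mul_smul_comm, ← smul_add, h.anti, smul_zero]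
    intro hij
    rw [Finset.mem_range] at hi hj
    exact hji (nsmul_injOn_Iio_addOrderOf (hm ▸ hj) (hm ▸ hi) hij.symm)

theorem fourier_anticomm_mul (h : IsSkewCyclic x s) {η : ZMod n} {m : ℕ} (hm : addOrderOf η = m)
    (ζ : k) (γ δ : ℤ) (hζ0 : ζ ≠ 0) {v : E} (hv : ∀ j : ℕ, x (j • η) ^ 2 * v = x 0 ^ 2 * v) :
    fourier x m η ζ γ * (fourier x m η ζ δ * v) + fourier x m η ζ δ * (fourier x m η ζ γ * v)
      = (2 * ∑ j ∈ Finset.range m, (ζ ^ (-(γ + δ))) ^ j) • (x 0 ^ 2 * v) := by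
  rw [← mul_assoc, ← mul_assoc, ← add_mul, h.fourier_anticomm hm ζ γ δ hζ0, Finset.sum_mul,
    Finset.mul_sum, Finset.sum_smul]
  exact Finset.sum_congr rfl fun j _ => by rw [smul_mul_assoc, hv]

/-- Suppose that the powers of `s` sum to zero, that `x (i + g) ^ 2` and `x i ^ 2` agree on good
elements for `g ∈ H`, and that for `g ∉ H` some difference `x i ^ 2 - x (i + g) ^ 2` preserves good
elements. Then any terms outside `H` can be eliminated from the sum, at the cost of coefficients
which all act on good elements as one goodness-preserving `b` for `g ∈ H`. -/
theorem exists_eliminate [NeZero n] (h : IsSkewCyclic x s)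
    (hsum : ∑ g : ZMod n, s ^ g.val = 0) (Good : E → Prop) (H : Set (ZMod n))
    (hH : ∀ g ∈ H, ∀ i, ∀ w, Good w → x (i + g) ^ 2 * w = x i ^ 2 * w)
    (hG : ∀ g ∉ H, ∃ i, ∀ w, Good w → Good ((x i ^ 2 - x (i + g) ^ 2) * w))
    (F : Finset (ZMod n)) (hF : ∀ g ∈ F, g ∉ H) :
    ∃ a : ZMod n → E, (∀ g i, Commute (x i ^ 2) (a g)) ∧ ∑ g, a g * s ^ g.val = 0 ∧
      (∀ g ∈ F, a g = 0) ∧ ∃ b : E, (∀ g ∈ H, ∀ w, Good w → a g * w = b * w) ∧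
        ∀ w, Good w → Good (b * w) := by
  induction F using Finset.induction_on with
  | empty =>
    exact ⟨fun _ => 1, fun _ _ => Commute.one_right _, by simpa using hsum, by simp, 1,
      by simp, by simp⟩
  | insert t F ht ih =>
    obtain ⟨a, hcomm, ha, haF, b, hb, hbG⟩ := ih fun g hg => hF g (Finset.mem_insert_of_mem hg)
    obtain ⟨i, hi⟩ := hG t (hF t (Finset.mem_insert_self _ _))
    have hyy : ∀ p q, Commute (x p ^ 2) (x q ^ 2) := fun p q => (h.sq_commute p q).pow_right 2
    refine ⟨fun g => a g * (x (i + g) ^ 2 - x (i + t) ^ 2), fun g j =>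
      (hcomm g j).mul_right ((hyy _ _).sub_right (hyy _ _)), ?_, ?_,
      b * (x i ^ 2 - x (i + t) ^ 2), ?_, ?_⟩
    · have e : ∀ g, a g * (x (i + g) ^ 2 - x (i + t) ^ 2) * s ^ g.val
          = a g * s ^ g.val * x i ^ 2 - x (i + t) ^ 2 * (a g * s ^ g.val) := by
        intro g
        rw [mul_assoc (a g) (s ^ g.val), h.pow_val_mul_sq, ← mul_assoc (x (i + t) ^ 2),
          (hcomm g _).eq, mul_sub, sub_mul]
        simp only [mul_assoc]
      rw [Finset.sum_congr rfl fun g _ => e g, Finset.sum_sub_distrib, ← Finset.sum_mul,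
        ← Finset.mul_sum, ha, zero_mul, mul_zero, sub_zero]
    · intro g hg
      rcases Finset.mem_insert.1 hg with rfl | hg
      · simp
      · simp [haF g hg]
    · intro g hg w hw
      rw [mul_assoc, mul_assoc, sub_mul, hH g hg i w hw, ← sub_mul]
      exact hb g hg _ (hi w hw)
    · intro w hw
      rw [mul_assoc]
      exact hbG _ (hi w hw)

theorem isNilpotent_sq_zero [IsAlgClosed k] [CharZero k] (h : IsSkewCyclic x s) (hodd : Odd n)
    (hdvd : ∀ d, d ∣ n → d ≠ 1 → 7 ≤ d) (hsum : ∑ i ∈ Finset.range n, s ^ i = 0) :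
    IsNilpotent (x 0 ^ 2) := by
  have : NeZero n := ⟨hodd.pos.ne'⟩
  by_contra hnil
  set T : Submodule k E := leftTorsion k (x 0 ^ 2)
  have hsum' : ∑ g : ZMod n, s ^ g.val = 0 := by
    obtain ⟨N, rfl⟩ : ∃ N, n = N + 1 := Nat.exists_eq_succ_of_ne_zero (NeZero.ne n)
    rw [← hsum]
    exact Fin.sum_univ_eq_sum_range (fun i => s ^ i) (N + 1)
  -- a maximal set of coincidences that supports nontorsion
  obtain ⟨D, ⟨w₀, hw₀, hw₀T⟩, hmax⟩ : ∃ D, Maximal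
      (fun D => D ∈ {D : Set (ZMod n × ZMod n) | ∃ w ∈ coincidence k x D, w ∉ T}) D := by
    refine Set.Finite.exists_maximal (Set.toFinite _) ⟨∅, 1, fun p hp => hp.elim, ?_⟩
    rintro ⟨a, ha⟩
    exact hnil ⟨a, by simpa using ha⟩
  have mem_D : ∀ i j w, w ∈ coincidence k x D → w ∉ T → x i ^ 2 * w = x j ^ 2 * w →
      (i, j) ∈ D := by
    intro i j w hw hwT hij
    refine hmax (y := insert (i, j) D) ⟨w, ?_, hwT⟩ (Set.subset_insert _ _)
      (Set.mem_insert _ _)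
    rintro p (rfl | hp)
    · exact hij
    · exact hw p hp
  let H : AddSubgroup (ZMod n) :=
    { carrier := {g | ∀ i, x (i + g) ^ 2 * w₀ = x i ^ 2 * w₀}
      add_mem' := fun {a b} ha hb i => by rw [← add_assoc, hb, ha]
      zero_mem' := fun i => by rw [add_zero]
      neg_mem' := fun {a} ha i => by rw [← ha (i + -a), neg_add_cancel_right] }
  have hH : ∀ g ∈ H, ∀ i, ∀ w ∈ coincidence k x D, x (i + g) ^ 2 * w = x i ^ 2 * w :=
    fun g hg i w hw => hw (i + g, i) (mem_D _ _ w₀ hw₀ hw₀T (hg i))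
  have hG : ∀ g ∉ H, ∃ i, ∀ w, (w ∈ coincidence k x D ∧ w ∉ T) →
      ((x i ^ 2 - x (i + g) ^ 2) * w ∈ coincidence k x D ∧ (x i ^ 2 - x (i + g) ^ 2) * w ∉ T) := by
    intro g hg
    obtain ⟨i, hi⟩ := not_forall.1 hg
    have hyy : ∀ p q, Commute (x p ^ 2) (x q ^ 2) := fun p q => (h.sq_commute p q).pow_right 2
    refine ⟨i, fun w ⟨hw, hwT⟩ => ⟨mul_mem_coincidence
      (fun j => (hyy _ _).sub_right (hyy _ _)) hw, ?_⟩⟩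
    rintro ⟨a, ha⟩
    have hcomm : ∀ j, Commute (x j ^ 2) ((x 0 ^ 2) ^ a) := fun j => (hyy _ _).pow_right a
    refine hi (hw₀ (i + g, i) (mem_D _ _ ((x 0 ^ 2) ^ a * w) (mul_mem_coincidence hcomm hw) ?_ ?_))
    · rintro ⟨b, hb⟩
      exact hwT ⟨b + a, by rw [pow_add, mul_assoc, hb]⟩
    · rw [← mul_assoc, ← mul_assoc, (hcomm _).eq, (hcomm _).eq, mul_assoc, mul_assoc, eq_comm,
        ← sub_eq_zero, ← mul_sub, ← sub_mul, ha]
  obtain ⟨⟨η, hη⟩, hgen⟩ := IsAddCyclic.exists_addMonoid_generator (α := H)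
  have hηH : ∀ j : ℕ, j • η ∈ H := H.nsmul_mem hη
  -- a nontorsion vector fixed by `H`
  obtain ⟨v, hvK, hvT, hv⟩ : ∃ v ∈ coincidence k x D, v ∉ T ∧ s ^ η.val * v = v := by
    set m := addOrderOf η with hm
    have hmn : m ∣ n := by simpa using addOrderOf_dvd_natCard η
    by_cases hm1 : m = 1
    · refine ⟨w₀, hw₀, hw₀T, ?_⟩
      rw [AddMonoid.addOrderOf_eq_one_iff.1 hm1, ZMod.val_zero, pow_zero, one_mul]
    have hm0 : m ≠ 0 := (Nat.pos_of_dvd_of_pos hmn hodd.pos).ne'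
    have : NeZero (m : k) := ⟨Nat.cast_ne_zero.2 hm0⟩
    obtain ⟨ζ, hζ⟩ := HasEnoughRootsOfUnity.exists_primitiveRoot k m
    have hζ0 : ζ ≠ 0 := hζ.ne_zero hm0
    have hc : (2 * m : k) ≠ 0 := mul_ne_zero two_ne_zero (Nat.cast_ne_zero.2 hm0)
    have hK0 : ∀ w ∈ coincidence k x D, ∀ j : ℕ, x (j • η) ^ 2 * w = x 0 ^ 2 * w := by
      intro w hw j
      simpa using hH _ (hηH j) 0 w hw
    refine exists_fixed_of_clifford (hodd.of_dvd_nat hmn) (hdvd m hmn hm1) hζ hc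
      (coincidence k x D) T (fourier x m η ζ) (s ^ η.val) (x 0 ^ 2) ?_
      (h.pow_val_mul_fourier (addOrderOf_nsmul_eq_zero η) hζ hm0)
      (fun γ v hv => mul_mem_coincidence (h.sq_commute_fourier m η ζ γ) hv) ?_
      (fun γ v hv => mul_mem_leftTorsion (h.sq_commute_fourier m η ζ γ 0) hv)
      (fun v => mem_leftTorsion_of_mul_mem) ?_ ?_ ⟨w₀, hw₀, hw₀T⟩
    · rw [← h.pow_val_nsmul, addOrderOf_nsmul_eq_zero, ZMod.val_zero, pow_zero]
    · intro w hw p hp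
      have e : ∀ i, x i ^ 2 * (s ^ η.val * w) = s ^ η.val * (x i ^ 2 * w) := by
        intro i
        have h1 := hH (-η) (H.neg_mem hη) i w hw
        rw [← h1, ← mul_assoc, ← mul_assoc, h.pow_val_mul_sq, neg_add_cancel_right]
      rw [e, e, hw p hp]
    · intro γ δ hγδ w hw
      rw [← add_eq_zero_iff_eq_neg, h.fourier_anticomm_mul hm.symm ζ γ δ hζ0 (hK0 w hw)]
      have h1 : ζ ^ (-(γ + δ)) ≠ 1 := by
        rw [ne_eq, hζ.zpow_eq_one_iff_dvd, dvd_neg]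
        exact hγδ
      rw [geom_sum_eq h1, ← zpow_natCast, zpow_comm, zpow_natCast, hζ.pow_eq_one]
      simp
    · intro γ w hw
      rw [h.fourier_anticomm_mul hm.symm ζ (-γ) γ hζ0 (hK0 w hw)]
      simp
  obtain ⟨a, -, ha, haF, b, hb, hbG⟩ := h.exists_eliminate hsum'
    (fun w => w ∈ coincidence k x D ∧ w ∉ T) H (fun g hg i w hw => hH g hg i w hw.1) hG
    (Set.toFinite (H : Set (ZMod n))ᶜ).toFinset (by simp)
  refine (hbG v ⟨hvK, hvT⟩).2 ?_
  classical
  have e : ∀ g, a g * s ^ g.val * v = if g ∈ H then b * v else 0 := by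
    intro g
    split_ifs with hg
    · obtain ⟨j, rfl⟩ : ∃ j : ℕ, j • η = g := by
        obtain ⟨j, hj⟩ := hgen ⟨g, hg⟩
        exact ⟨j, congrArg Subtype.val hj⟩
      have hfix : (s ^ η.val) ^ j * v = v := by
        induction j with
        | zero => simp
        | succ j ih => rw [pow_succ, mul_assoc, hv, ih (hηH j)]
      rw [mul_assoc, h.pow_val_nsmul, hfix, hb _ hg v ⟨hvK, hvT⟩]
    · rw [haF g (by simpa using hg), zero_mul, zero_mul]
  have hzero : (Nat.card H : k) • (b * v) = 0 := by
    have h1 := congrArg (· * v) ha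
    simp only [Finset.sum_mul, zero_mul, e, Finset.sum_ite, Finset.sum_const,
      smul_zero, add_zero] at h1
    rw [← h1, Nat.cast_smul_eq_nsmul, Nat.card_eq_fintype_card, Fintype.card_subtype]
  rw [(smul_eq_zero_iff_right (Nat.cast_ne_zero.2 Nat.card_pos.ne')).1 hzero]
  exact T.zero_mem

theorem isNilpotent [NeZero n] (h : IsSkewCyclic x s) (h0 : IsNilpotent (x 0 ^ 2)) (i : ZMod n) :
    IsNilpotent (x i) := by
  obtain ⟨a, ha⟩ := h0
  have hconj : ∀ b : ℕ, s ^ i.val * (x 0 ^ 2) ^ b = (x i ^ 2) ^ b * s ^ i.val := by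
    intro b
    induction b with
    | zero => simp
    | succ b ih =>
      rw [pow_succ, ← mul_assoc, ih, mul_assoc, h.pow_val_mul_sq, zero_add, ← mul_assoc, ← pow_succ]
  have hunit : s ^ i.val * s ^ (-i).val = 1 := by
    rw [← h.pow_val_add, add_neg_cancel, ZMod.val_zero, pow_zero]
  refine ⟨2 * a, ?_⟩
  have h1 := hconj a
  rw [ha, mul_zero] at h1
  rw [_root_.pow_mul, ← mul_one ((x i ^ 2) ^ a), ← hunit, ← mul_assoc, ← h1, zero_mul]

theorem finiteDimensional [NeZero n] (h : IsSkewCyclic x s) (hnil : ∀ i, IsNilpotent (x i))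
    (hgen : Algebra.adjoin k (insert s (Set.range x)) = ⊤) : FiniteDimensional k E := by
  let L : E → Submodule k E := fun e => Submodule.span k {e}
  have hL : ∀ a b, L a * L b = L (a * b) := fun a b => by
    simp only [L, Submodule.span_mul_span, Set.singleton_mul_singleton]
  have hLpow : ∀ e (a : ℕ), L e ^ a = L (e ^ a) := fun e a => by
    simp only [L, Submodule.span_pow, Set.singleton_pow]
  obtain ⟨X, hX⟩ : ∃ X : Submodule k E, X = ∑ i, L (x i) := ⟨_, rfl⟩
  have hxX : ∀ i, x i ∈ X := fun i =>
    hX ▸ (Finset.single_le_sum (f := fun i => L (x i)) (fun _ _ => bot_le) (Finset.mem_univ i))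
      (Submodule.mem_span_singleton_self _)
  have hXnil : IsNilpotent X := by
    rw [hX]
    refine Commute.isNilpotent_sum (fun i _ => ?_) fun i j _ _ => ?_
    · obtain ⟨a, ha⟩ := hnil i
      exact ⟨a, by rw [hLpow, ha]; simp [L]⟩
    · rcases eq_or_ne i j with rfl | hij
      · exact Commute.refl _
      · change L (x i) * L (x j) = L (x j) * L (x i)
        rw [hL, hL, add_eq_zero_iff_eq_neg.1 (h.anti i j hij)]
        simp only [L]
        rw [← Set.neg_singleton, Submodule.span_neg]
  have hSX : Commute (L s) X := by
    change L s * X = X * L s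
    simp only [hX, Finset.mul_sum, Finset.sum_mul, hL, h.comm]
    exact Fintype.sum_equiv (Equiv.addRight 1) _ _ fun i => rfl
  have hsumfg : ∀ {ι : Type} (t : Finset ι) (f : ι → Submodule k E), (∀ i, (f i).FG) →
      (∑ i ∈ t, f i).FG := fun t f hf =>
    Finset.sum_induction f Submodule.FG (fun _ _ => Submodule.FG.sup) Submodule.fg_bot
      fun i _ => hf i
  have hLfg : ∀ e, (L e).FG := fun e => Submodule.fg_span_singleton e
  have hXfg : X.FG := hX ▸ hsumfg _ _ fun i => hLfg _
  have hsS : s ∈ L s := Submodule.mem_span_singleton_self s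
  have hSn : L s ^ n = 1 := by rw [hLpow, h.pow_eq_one]; exact Submodule.one_eq_span.symm
  have hSfg := hLfg s
  generalize L s = S at hSfg hSn hsS hSX
  obtain ⟨d, hd⟩ := hXnil
  have hd' : X ^ (d + 1) = 0 := by rw [pow_succ, hd, zero_mul]
  obtain ⟨P, hP⟩ : ∃ P : Submodule k E, P = ∑ a ∈ Finset.range (d + 1), X ^ a := ⟨_, rfl⟩
  obtain ⟨Q, hQ⟩ : ∃ Q : Submodule k E, Q = ∑ a ∈ Finset.range n, S ^ a := ⟨_, rfl⟩
  have hP1 : 1 ≤ P := hP ▸ one_le_geom_sum X (Nat.succ_ne_zero d)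
  have hQ1 : 1 ≤ Q := hQ ▸ one_le_geom_sum S (NeZero.ne n)
  have hXP : X * P ≤ P := by
    have h1 := mul_geom_sum_le X (d + 1)
    rwa [hd', add_zero, ← hP] at h1
  have hSQ : S * Q ≤ Q := by
    have h1 := mul_geom_sum_le S n
    rw [hSn, ← hQ] at h1
    exact h1.trans (sup_le le_rfl hQ1)
  have hSP : Commute S P := hP ▸ Commute.sum_right _ _ _ fun a _ => hSX.pow_right a
  have hXV : X * (P * Q) ≤ P * Q := by
    rw [← mul_assoc]
    exact mul_le_mul' hXP le_rfl
  have hSV : S * (P * Q) ≤ P * Q := by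
    rw [← mul_assoc, hSP.eq, mul_assoc]
    exact mul_le_mul' le_rfl hSQ
  have hone : (1 : E) ∈ P * Q := by
    simpa using Submodule.mul_mem_mul (Submodule.one_le.1 hP1) (Submodule.one_le.1 hQ1)
  have hVfg : (P * Q).FG := (hP ▸ hsumfg _ _ fun a => hXfg.pow a : P.FG).mul
    (hQ ▸ hsumfg _ _ fun a => hSfg.pow a)
  generalize P * Q = V at hVfg hone hXV hSV
  have htop : V = ⊤ := by
    rw [eq_top_iff]
    rintro e -
    have hmul : ∀ v ∈ V, e * v ∈ V := by
      have he : e ∈ Algebra.adjoin k (insert s (Set.range x)) := hgen ▸ Algebra.mem_top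
      induction he using Algebra.adjoin_induction with
      | mem a ha =>
        intro v hv
        rcases ha with rfl | ⟨i, rfl⟩
        · exact hSV (Submodule.mul_mem_mul hsS hv)
        · exact hXV (Submodule.mul_mem_mul (hxX i) hv)
      | algebraMap r =>
        intro v hv
        rw [← Algebra.smul_def]
        exact V.smul_mem r hv
      | add a b _ _ ha hb => intro v hv; rw [add_mul]; exact V.add_mem (ha v hv) (hb v hv)
      | mul a b _ _ ha hb => intro v hv; rw [mul_assoc]; exact ha _ (hb v hv)
    simpa using hmul 1 hone
  exact ⟨htop ▸ hVfg⟩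

end Algebra

end IsSkewCyclic

namespace NCIS

/-- The image of `x_i` in `E`. -/
noncomputable def xE (k : Type*) [Field k] (n : ℕ) (i : ZMod n) : Equot k n :=
  RingQuot.mkAlgHom k _ (xg k n i)

/-- The image of `s` in `E`. -/
noncomputable def sE (k : Type*) [Field k] (n : ℕ) : Equot k n :=
  RingQuot.mkAlgHom k _ (sg k n)

theorem isSkewCyclic_Equot (k : Type*) [Field k] (n : ℕ) : IsSkewCyclic (xE k n) (sE k n) where
  anti i j hij := by
    have h1 := RingQuot.mkAlgHom_rel k (SGRel.anti (k := k) i j hij)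
    simp only [map_add, map_mul, map_zero] at h1
    simp only [xE, xg, ← map_mul, ← map_add] at h1 ⊢
    rw [h1, map_zero]
  pow_eq_one := by
    have h1 := RingQuot.mkAlgHom_rel k (SGRel.spow (k := k) (n := n))
    rw [map_pow, map_one] at h1
    rw [sE, sg, ← map_pow, h1, map_one]
  comm i := by
    have h1 := RingQuot.mkAlgHom_rel k (SGRel.scomm (k := k) i)
    rw [map_mul, map_mul] at h1
    rw [xE, xE, sE, xg, xg, sg, ← map_mul, h1, map_mul]

theorem sum_sE_pow (k : Type*) [Field k] [CharZero k] (n : ℕ) [NeZero n] :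
    ∑ i ∈ Finset.range n, sE k n ^ i = 0 := by
  have h1 := RingQuot.mkAlgHom_rel k
    (s := fun a b : SkewGroup k n => a = e0 k n ∧ b = 0) ⟨rfl, rfl⟩
  rw [e0, map_smul, map_zero, map_sum] at h1
  simp only [map_pow] at h1
  exact (smul_eq_zero_iff_right (inv_ne_zero (Nat.cast_ne_zero.2 (NeZero.ne n)))).1 h1

theorem adjoin_Equot (k : Type*) [Field k] (n : ℕ) :
    Algebra.adjoin k (insert (sE k n) (Set.range (xE k n))) = ⊤ := by
  rw [eq_top_iff]
  rintro e -
  obtain ⟨a, rfl⟩ := RingQuot.mkAlgHom_surjective k _ e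
  obtain ⟨f, rfl⟩ := RingQuot.mkAlgHom_surjective k _ a
  induction f using FreeAlgebra.induction with
  | grade0 r => simp only [AlgHom.commutes]; exact Subalgebra.algebraMap_mem _ r
  | grade1 g =>
    refine Algebra.subset_adjoin ?_
    rcases g with i | u
    · exact Or.inr ⟨i, rfl⟩
    · exact Or.inl rfl
  | mul a b ha hb => simp only [map_mul]; exact mul_mem ha hb
  | add a b ha hb => simp only [map_add]; exact add_mem ha hb

end NCIS

open NCIS in
/-- Theorem 8.7: if `n = p₁ p₂` for distinct primes `p₁, p₂ ≥ 17`, then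
`E = (A#C_n)/(e₀)` is finite-dimensional over `k`. -/
theorem skewGroup_quotient_finiteDimensional_of_eq_mul_of_two_large_primes
    (k : Type*) [Field k] [IsAlgClosed k] [CharZero k]
    (n p₁ p₂ : ℕ) (hp₁ : p₁.Prime) (hp₂ : p₂.Prime) (hne : p₁ ≠ p₂)
    (h₁ : 17 ≤ p₁) (h₂ : 17 ≤ p₂) (hn : n = p₁ * p₂) :
    FiniteDimensional k (Equot k n) := by
  have hodd : Odd n := hn ▸ (hp₁.odd_of_ne_two (by omega)).mul (hp₂.odd_of_ne_two (by omega))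
  have : NeZero n := ⟨hodd.pos.ne'⟩
  have hdvd : ∀ d, d ∣ n → d ≠ 1 → 7 ≤ d := by
    intro d hd hd1
    have hq := Nat.minFac_prime hd1
    have hqn : d.minFac ∣ p₁ * p₂ := hn ▸ (Nat.minFac_dvd d).trans hd
    have hle := Nat.minFac_le (Nat.pos_of_dvd_of_pos hd hodd.pos)
    rcases (Nat.Prime.dvd_mul hq).1 hqn with h | h
    · rw [(Nat.prime_dvd_prime_iff_eq hq hp₁).1 h] at hle
      omega
    · rw [(Nat.prime_dvd_prime_iff_eq hq hp₂).1 h] at hle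
      omega
  have hE := isSkewCyclic_Equot k n
  exact hE.finiteDimensional (hE.isNilpotent (hE.isNilpotent_sq_zero (k := k) hodd hdvd
    (sum_sE_pow k n))) (adjoin_Equot k n)
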